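/- Let n > 3, s ≥ 1 and let Λ = (λ_1,…,λ_n), λ_j ∈ ℂ, be weakly hyperbolic. Let X = (0,z) ∈ Z_{(Λ,n,s)} be a point with w_1 = ⋯ = w_s = 0. Then the set {v ∈ T_X : dα_X(v,u) = 0 for all u ∈ T_X} is exactly the set of vectors v(T,μ) = −i(0, …, 0, (2 Re(T λ_1) + μ) z_1, …, (2 Re(T λ_n) + μ) z_n) with T ∈ ℂ and μ ∈ ℝ, and this set is a real vector subspace of dimension 3. -/

import Mathlib

open scoped BigOperators

/-- `Λ` is weakly hyperbolic (`k = 2`). -/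
def WeaklyHyperbolicC {n : ℕ} (Λ : Fin n → ℂ) : Prop :=
  ∀ J : Finset (Fin n), J.card ≤ 2 → (0 : ℂ) ∉ convexHull ℝ (Λ '' ↑J)

/-- The manifold `Z_{(Λ,n,s)} ⊆ ℂ^s × ℂ^n` cut out by
`F_s(w,z) = ∑ w_r² + ∑ λ_j |z_j|² = 0` and `ρ_s(w,z) = ∑ |w_r|² + ∑ |z_j|² = 1`. -/
def ZLS (s : ℕ) {n : ℕ} (Λ : Fin n → ℂ) : Set ((Fin s → ℂ) × (Fin n → ℂ)) :=
  {X | (∑ r, X.1 r ^ 2) + (∑ j, Λ j * (Complex.normSq (X.2 j) : ℂ)) = 0 ∧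
       (∑ r, Complex.normSq (X.1 r)) + (∑ j, Complex.normSq (X.2 j)) = 1}

/-- The tangent space of `Z_{(Λ,n,s)}` at `X = (w,z)`: all `v = (a,b) ∈ ℂ^s × ℂ^n` with
`∑ 2 w_r a_r + ∑ λ_j (conj(z_j) b_j + z_j conj(b_j)) = 0` and
`Re(∑ conj(w_r) a_r + ∑ conj(z_j) b_j) = 0`. -/
def TangentAt (s : ℕ) {n : ℕ} (Λ : Fin n → ℂ)
    (X v : (Fin s → ℂ) × (Fin n → ℂ)) : Prop :=
  ((∑ r, 2 * X.1 r * v.1 r) +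
      (∑ j, Λ j * ((starRingEnd ℂ) (X.2 j) * v.2 j + X.2 j * (starRingEnd ℂ) (v.2 j))) = 0) ∧
  ((∑ r, (starRingEnd ℂ) (X.1 r) * v.1 r) + (∑ j, (starRingEnd ℂ) (X.2 j) * v.2 j)).re = 0

/-- The `1`-form
`α_X(a,b) = i(∑ (w_r conj(a_r) − conj(w_r) a_r) + ∑ (z_j conj(b_j) − conj(z_j) b_j))`. -/
noncomputable def alphaForm {s n : ℕ} (X v : (Fin s → ℂ) × (Fin n → ℂ)) : ℂ :=
  Complex.I *
    ((∑ r, (X.1 r * (starRingEnd ℂ) (v.1 r) - (starRingEnd ℂ) (X.1 r) * v.1 r)) +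
     (∑ j, (X.2 j * (starRingEnd ℂ) (v.2 j) - (starRingEnd ℂ) (X.2 j) * v.2 j)))

/-- The constant `2`-form
`dα(u,v) = 2i(∑ (u_r conj(v_r) − v_r conj(u_r)) + ∑ (u_{s+j} conj(v_{s+j}) − v_{s+j} conj(u_{s+j})))`. -/
noncomputable def dAlpha {s n : ℕ} (u v : (Fin s → ℂ) × (Fin n → ℂ)) : ℂ :=
  2 * Complex.I *
    ((∑ r, (u.1 r * (starRingEnd ℂ) (v.1 r) - v.1 r * (starRingEnd ℂ) (u.1 r))) +
     (∑ j, (u.2 j * (starRingEnd ℂ) (v.2 j) - v.2 j * (starRingEnd ℂ) (u.2 j))))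

/-- The vector `v(T,μ) = −i(2 conj(T) conj(w_1) + μ w_1, …, 2 conj(T) conj(w_s) + μ w_s,
(2 Re(T λ_1) + μ) z_1, …, (2 Re(T λ_n) + μ) z_n)`. -/
noncomputable def vTmu {s n : ℕ} (Λ : Fin n → ℂ) (X : (Fin s → ℂ) × (Fin n → ℂ)) (T : ℂ) (μ : ℝ) :
    (Fin s → ℂ) × (Fin n → ℂ) :=
  (fun r => -Complex.I * (2 * (starRingEnd ℂ) T * (starRingEnd ℂ) (X.1 r) + (μ : ℂ) * X.1 r),
   fun j => -Complex.I * (((2 * (T * Λ j).re + μ : ℝ) : ℂ) * X.2 j))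

/-- The standard real inner product `Re ∑ conj(p_i) u_i` on `ℂ^s × ℂ^n`. -/
noncomputable def realPairing (s n : ℕ) :
    ((Fin s → ℂ) × (Fin n → ℂ)) →ₗ[ℝ] ((Fin s → ℂ) × (Fin n → ℂ)) →ₗ[ℝ] ℝ :=
  LinearMap.mk₂ ℝ
    (fun p u => (∑ r, ((p.1 r).re * (u.1 r).re + (p.1 r).im * (u.1 r).im)) +
      ∑ j, ((p.2 j).re * (u.2 j).re + (p.2 j).im * (u.2 j).im))
    (fun p q u => by
      simp only [Prod.fst_add, Prod.snd_add, Pi.add_apply, Complex.add_re, Complex.add_im,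
        add_mul, Finset.sum_add_distrib]
      ring)
    (fun c p u => by
      simp only [Prod.smul_fst, Prod.smul_snd, Pi.smul_apply, Complex.smul_re, Complex.smul_im,
        smul_eq_mul, mul_assoc, ← mul_add, ← Finset.mul_sum])
    (fun p u v => by
      simp only [Prod.fst_add, Prod.snd_add, Pi.add_apply, Complex.add_re, Complex.add_im,
        mul_add, Finset.sum_add_distrib]
      ring)
    (fun c p u => by
      simp only [Prod.smul_fst, Prod.smul_snd, Pi.smul_apply, Complex.smul_re, Complex.smul_im,
        smul_eq_mul, mul_left_comm _ c, ← mul_add, ← Finset.mul_sum])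

lemma realPairing_apply {s n : ℕ} (p u : (Fin s → ℂ) × (Fin n → ℂ)) :
    realPairing s n p u =
      (∑ r, ((p.1 r).re * (u.1 r).re + (p.1 r).im * (u.1 r).im)) +
        ∑ j, ((p.2 j).re * (u.2 j).re + (p.2 j).im * (u.2 j).im) := rfl

lemma realPairing_injective (s n : ℕ) : Function.Injective (realPairing s n) := by
  rw [← LinearMap.ker_eq_bot, LinearMap.ker_eq_bot']
  intro p hp
  have h : realPairing s n p p = 0 := by rw [hp]; rfl
  simp only [realPairing_apply, ← Complex.normSq_apply] at h
  have h₁ : 0 ≤ ∑ r, Complex.normSq (p.1 r) :=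
    Finset.sum_nonneg fun r _ => Complex.normSq_nonneg _
  have h₂ : 0 ≤ ∑ j, Complex.normSq (p.2 j) :=
    Finset.sum_nonneg fun j _ => Complex.normSq_nonneg _
  have e₁ := (Finset.sum_eq_zero_iff_of_nonneg fun r _ => Complex.normSq_nonneg (p.1 r)).1
    (by linarith)
  have e₂ := (Finset.sum_eq_zero_iff_of_nonneg fun j _ => Complex.normSq_nonneg (p.2 j)).1
    (by linarith)
  ext i
  · exact Complex.normSq_eq_zero.1 (e₁ i (Finset.mem_univ i))
  · exact Complex.normSq_eq_zero.1 (e₂ i (Finset.mem_univ i))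

/-- The vectors `(0, Re(λ_j) z_j)`, `(0, Im(λ_j) z_j)` and `(0, z_j)`, whose orthogonal
complement is the tangent space at `(0, z)`. -/
noncomputable def bindingNormals (s : ℕ) {n : ℕ} (Λ z : Fin n → ℂ) :
    Fin 3 → (Fin s → ℂ) × (Fin n → ℂ) :=
  ![(0, fun j => (Λ j).re • z j), (0, fun j => (Λ j).im • z j), (0, z)]

lemma tangentAt_iff_realPairing {s n : ℕ} {Λ : Fin n → ℂ} {X : (Fin s → ℂ) × (Fin n → ℂ)}
    (hw : X.1 = 0) (u : (Fin s → ℂ) × (Fin n → ℂ)) :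
    TangentAt s Λ X u ↔ ∀ i, realPairing s n (bindingNormals s Λ X.2 i) u = 0 := by
  have hre : (∑ j, Λ j * ((starRingEnd ℂ) (X.2 j) * u.2 j + X.2 j * (starRingEnd ℂ) (u.2 j))).re
      = 2 * realPairing s n (bindingNormals s Λ X.2 0) u := by
    simp only [bindingNormals, realPairing_apply, Complex.re_sum, Matrix.cons_val, Pi.zero_apply,
      Complex.zero_re, Complex.zero_im, zero_mul, add_zero, Finset.sum_const_zero, zero_add,
      Finset.mul_sum]
    refine Finset.sum_congr rfl fun j _ => ?_
    simp
    ring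
  have him : (∑ j, Λ j * ((starRingEnd ℂ) (X.2 j) * u.2 j + X.2 j * (starRingEnd ℂ) (u.2 j))).im
      = 2 * realPairing s n (bindingNormals s Λ X.2 1) u := by
    simp only [bindingNormals, realPairing_apply, Complex.im_sum, Matrix.cons_val, Pi.zero_apply,
      Complex.zero_re, Complex.zero_im, zero_mul, add_zero, Finset.sum_const_zero, zero_add,
      Finset.mul_sum]
    refine Finset.sum_congr rfl fun j _ => ?_
    simp
    ring
  have hρ : (∑ j, (starRingEnd ℂ) (X.2 j) * u.2 j).re
      = realPairing s n (bindingNormals s Λ X.2 2) u := by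
    simp only [bindingNormals, realPairing_apply, Complex.re_sum, Matrix.cons_val, Pi.zero_apply,
      Complex.zero_re, Complex.zero_im, zero_mul, add_zero, Finset.sum_const_zero, zero_add]
    refine Finset.sum_congr rfl fun j _ => ?_
    simp
  simp only [TangentAt, hw, Pi.zero_apply, mul_zero, zero_mul, map_zero, Finset.sum_const_zero,
    zero_add, Complex.ext_iff, hre, him, hρ, Complex.zero_re, Complex.zero_im, Fin.forall_fin_succ,
    mul_eq_zero, OfNat.ofNat_ne_zero, false_or]
  simp [and_assoc]

lemma dAlpha_eq_realPairing {s n : ℕ} (v u : (Fin s → ℂ) × (Fin n → ℂ)) :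
    dAlpha v u = ((-4 * realPairing s n (-Complex.I • v) u : ℝ) : ℂ) := by
  have key (a b : ℂ) : a * (starRingEnd ℂ) b - b * (starRingEnd ℂ) a
      = 2 * Complex.I * (((-Complex.I • a).re * b.re + (-Complex.I • a).im * b.im : ℝ) : ℂ) := by
    apply Complex.ext <;> simp <;> ring
  simp only [dAlpha, realPairing_apply, key, ← Finset.mul_sum, Prod.smul_fst, Prod.smul_snd,
    Pi.smul_apply]
  push_cast
  linear_combination 4 * ((∑ r, (((-Complex.I • v.1 r).re : ℂ) * (u.1 r).re
    + ((-Complex.I • v.1 r).im : ℂ) * (u.1 r).im)) + ∑ j, (((-Complex.I • v.2 j).re : ℂ) * (u.2 j).re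
    + ((-Complex.I • v.2 j).im : ℂ) * (u.2 j).im)) * Complex.I_sq

lemma forall_dAlpha_eq_zero_iff_mem_span {s n : ℕ} {Λ : Fin n → ℂ}
    {X : (Fin s → ℂ) × (Fin n → ℂ)} (hw : X.1 = 0) (v : (Fin s → ℂ) × (Fin n → ℂ)) :
    (∀ u, TangentAt s Λ X u → dAlpha v u = 0) ↔
      -Complex.I • v ∈ Submodule.span ℝ (Set.range (bindingNormals s Λ X.2)) := by
  have hd (u) : dAlpha v u = 0 ↔ realPairing s n (-Complex.I • v) u = 0 := by
    rw [dAlpha_eq_realPairing, Complex.ofReal_eq_zero]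
    simp
  simp only [hd, tangentAt_iff_realPairing hw]
  constructor
  · intro h
    have hspan := mem_span_of_iInf_ker_le_ker
      (L := fun i => realPairing s n (bindingNormals s Λ X.2 i))
      (K := realPairing s n (-Complex.I • v)) fun u hu => by
        simp only [Submodule.mem_iInf, LinearMap.mem_ker] at hu ⊢
        exact h u hu
    obtain ⟨c, hc⟩ := (Submodule.mem_span_range_iff_exists_fun ℝ).1 hspan
    refine (Submodule.mem_span_range_iff_exists_fun ℝ).2 ⟨c, realPairing_injective s n ?_⟩
    simpa only [map_sum, map_smul] using hc
  · intro h u hu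
    obtain ⟨c, hc⟩ := (Submodule.mem_span_range_iff_exists_fun ℝ).1 h
    rw [← hc]
    simp [hu]

lemma neg_I_smul_mem_span_bindingNormals_iff {s n : ℕ} {Λ z : Fin n → ℂ}
    (v : (Fin s → ℂ) × (Fin n → ℂ)) :
    -Complex.I • v ∈ Submodule.span ℝ (Set.range (bindingNormals s Λ z)) ↔
      ∃ (T : ℂ) (μ : ℝ),
        v = (0, fun j => -Complex.I * (((2 * (T * Λ j).re + μ : ℝ) : ℂ) * z j)) := by
  have hv (p : (Fin s → ℂ) × (Fin n → ℂ)) : p = -Complex.I • v ↔ v = Complex.I • p := by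
    constructor
    · rintro rfl
      simp [smul_smul]
    · rintro rfl
      simp [smul_smul]
  simp only [Submodule.mem_span_range_iff_exists_fun, hv, Fin.sum_univ_three]
  constructor
  · rintro ⟨c, rfl⟩
    refine ⟨⟨-c 0 / 2, c 1 / 2⟩, -c 2, ?_⟩
    ext j
    · simp [bindingNormals]
    · simp [bindingNormals]
      ring
  · rintro ⟨T, μ, rfl⟩
    refine ⟨![-2 * T.re, 2 * T.im, -μ], ?_⟩
    ext j
    · simp [bindingNormals]
    · simp [bindingNormals]
      ring

lemma tangentAt_neg_I_smul {s n : ℕ} {Λ : Fin n → ℂ} {X : (Fin s → ℂ) × (Fin n → ℂ)}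
    (hw : X.1 = 0) (c : Fin n → ℝ) :
    TangentAt s Λ X (0, fun j => -Complex.I * ((c j : ℂ) * X.2 j)) := by
  refine ⟨?_, ?_⟩
  · simp only [hw, Pi.zero_apply, mul_zero, Finset.sum_const_zero, zero_add]
    refine Finset.sum_eq_zero fun j _ => ?_
    simp
    ring_nf
    simp
  · simp only [Pi.zero_apply, mul_zero, Finset.sum_const_zero, zero_add, Complex.re_sum]
    refine Finset.sum_eq_zero fun j _ => ?_
    simp
    ring

lemma WeaklyHyperbolicC.ne_zero {n : ℕ} {Λ : Fin n → ℂ} (hΛ : WeaklyHyperbolicC Λ) (j : Fin n) :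
    Λ j ≠ 0 := by
  intro h
  exact hΛ {j} (by simp) (by simp [h])

lemma WeaklyHyperbolicC.add_ne_zero {n : ℕ} {Λ : Fin n → ℂ} (hΛ : WeaklyHyperbolicC Λ)
    (j k : Fin n) {a b : ℝ} (ha : 0 < a) (hb : 0 ≤ b) : a • Λ j + b • Λ k ≠ 0 := by
  intro h
  have hab : 0 < a + b := by linarith
  refine hΛ {j, k} Finset.card_le_two ?_
  rw [Finset.coe_pair, Set.image_pair, convexHull_pair]
  refine ⟨a / (a + b), b / (a + b), by positivity, by positivity, by field_simp, ?_⟩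
  rw [div_eq_inv_mul, div_eq_inv_mul, mul_smul, mul_smul, ← smul_add, h, smul_zero]

/-- If `0` is a nontrivial nonnegative combination of the weakly hyperbolic `λ_j`, then the `λ_j`
in its support do not lie on a common real line through the origin. -/
lemma WeaklyHyperbolicC.eq_zero_of_re_mul_eq_zero {n : ℕ} {Λ : Fin n → ℂ}
    (hΛ : WeaklyHyperbolicC Λ) {m : Fin n → ℝ} (hm : ∀ j, 0 ≤ m j) {k : Fin n} (hk : m k ≠ 0)
    (hsum : ∑ j, Λ j * (m j : ℂ) = 0) {T : ℂ} (hT : ∀ j, m j ≠ 0 → (T * Λ j).re = 0) :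
    T = 0 := by
  by_contra hT0
  have hpos : ∀ j, m j ≠ 0 → 0 < (T * Λ j).im * (T * Λ k).im := by
    intro j hj
    by_contra! hle
    have hk0 : (T * Λ k).im ≠ 0 := fun h =>
      mul_ne_zero hT0 (hΛ.ne_zero k) (Complex.ext (hT k hk) h)
    refine hΛ.add_ne_zero j k (a := (T * Λ k).im ^ 2) (b := -((T * Λ j).im * (T * Λ k).im))
      (by positivity) (by linarith) ?_
    refine (mul_eq_zero.1 (?_ : T * _ = 0)).resolve_left hT0
    rw [mul_add, mul_smul_comm, mul_smul_comm]
    apply Complex.ext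
    · simp only [Complex.add_re, Complex.smul_re, hT j hj, hT k hk]
      simp
    · simp only [Complex.add_im, Complex.smul_im, smul_eq_mul, Complex.zero_im]
      ring
  have hzero : ∑ j, (T * Λ j).im * (T * Λ k).im * m j = 0 := by
    have h := congrArg (fun x : ℂ => (T * x).im * (T * Λ k).im) hsum
    simp only [Finset.mul_sum, Complex.im_sum, Finset.sum_mul, ← mul_assoc, Complex.im_mul_ofReal,
      mul_zero, Complex.zero_im, zero_mul] at h
    rw [← h]
    exact Finset.sum_congr rfl fun j _ => by ring
  have hnonneg : ∀ j, 0 ≤ (T * Λ j).im * (T * Λ k).im * m j := fun j => by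
    by_cases hj : m j = 0
    · simp [hj]
    · exact mul_nonneg (hpos j hj).le (hm j)
  have h := (Finset.sum_eq_zero_iff_of_nonneg fun j _ => hnonneg j).1 hzero k (Finset.mem_univ k)
  exact mul_ne_zero (hpos k hk).ne' hk h

/-- The real-linear map `(T, μ) ↦ v(T, μ)` at a point `(0, z)`. -/
noncomputable def bindingKernelMap (s : ℕ) {n : ℕ} (Λ z : Fin n → ℂ) :
    (ℂ × ℝ) →ₗ[ℝ] ((Fin s → ℂ) × (Fin n → ℂ)) where
  toFun p := (0, fun j => -Complex.I * (((2 * (p.1 * Λ j).re + p.2 : ℝ) : ℂ) * z j))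
  map_add' p q := by
    ext j
    · simp
    · simp
      ring
  map_smul' c p := by
    ext j
    · simp
    · simp
      ring

lemma bindingKernelMap_injective {n s : ℕ} {Λ : Fin n → ℂ} (hΛ : WeaklyHyperbolicC Λ)
    {z : Fin n → ℂ} (hF : ∑ j, Λ j * (Complex.normSq (z j) : ℂ) = 0)
    (hρ : ∑ j, Complex.normSq (z j) = 1) :
    Function.Injective (bindingKernelMap s Λ z) := by
  rw [← LinearMap.ker_eq_bot, LinearMap.ker_eq_bot']
  rintro ⟨T, μ⟩ h
  have hc : ∀ j, Complex.normSq (z j) ≠ 0 → 2 * (T * Λ j).re + μ = 0 := by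
    intro j hj
    have h' := congrFun (congrArg Prod.snd h) j
    have h'' : -Complex.I * (((2 * (T * Λ j).re + μ : ℝ) : ℂ) * z j) = 0 := h'
    rw [mul_eq_zero, mul_eq_zero, Complex.ofReal_eq_zero] at h''
    exact (h''.resolve_left (by simp)).resolve_right fun hz => hj (by simp [hz])
  have hμ : μ = 0 := by
    have hF' := congrArg (fun x : ℂ => (T * x).re) hF
    simp only [Finset.mul_sum, Complex.re_sum, ← mul_assoc, Complex.re_mul_ofReal, mul_zero,
      Complex.zero_re] at hF'
    calc μ = 2 * ∑ j, (T * Λ j).re * Complex.normSq (z j)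
          + μ * ∑ j, Complex.normSq (z j) := by rw [hF', hρ]; ring
      _ = ∑ j, (2 * (T * Λ j).re + μ) * Complex.normSq (z j) := by
        rw [Finset.mul_sum, Finset.mul_sum, ← Finset.sum_add_distrib]
        exact Finset.sum_congr rfl fun j _ => by ring
      _ = 0 := Finset.sum_eq_zero fun j _ => by
        by_cases hj : Complex.normSq (z j) = 0
        · rw [hj, mul_zero]
        · rw [hc j hj, zero_mul]
  obtain ⟨k, -, hk⟩ := Finset.exists_ne_zero_of_sum_ne_zero (hρ.trans_ne one_ne_zero)
  have hT : T = 0 := hΛ.eq_zero_of_re_mul_eq_zero (fun j => Complex.normSq_nonneg (z j)) hk hF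
    fun j hj => by linarith [hc j hj]
  rw [hT, hμ]
  rfl

/-- At a point `X = (0,z) ∈ Z_{(Λ,n,s)}` with `w_1 = ⋯ = w_s = 0`, the set
`{v ∈ T_X : dα_X(v,u) = 0 for all u ∈ T_X}` consists exactly of the vectors
`v(T,μ) = −i(0,…,0, (2 Re(T λ_1) + μ) z_1, …, (2 Re(T λ_n) + μ) z_n)` with `T ∈ ℂ`, `μ ∈ ℝ`,
and is a real vector subspace of dimension `3` (expressed as the range of an injective
real-linear map on `ℂ × ℝ`). -/
theorem kernel_dAlpha_at_binding_point {n s : ℕ} (hn : 3 < n) (hs : 1 ≤ s)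
    (Λ : Fin n → ℂ) (hΛ : WeaklyHyperbolicC Λ)
    (X : (Fin s → ℂ) × (Fin n → ℂ)) (hX : X ∈ ZLS s Λ) (hw : X.1 = 0) :
    {v : (Fin s → ℂ) × (Fin n → ℂ) | TangentAt s Λ X v ∧
        ∀ u : (Fin s → ℂ) × (Fin n → ℂ), TangentAt s Λ X u → dAlpha v u = 0}
      = {v : (Fin s → ℂ) × (Fin n → ℂ) | ∃ (T : ℂ) (μ : ℝ),
          v = (0, fun j => -Complex.I * (((2 * (T * Λ j).re + μ : ℝ) : ℂ) * X.2 j))} ∧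
    ∃ f : (ℂ × ℝ) →ₗ[ℝ] ((Fin s → ℂ) × (Fin n → ℂ)), Function.Injective f ∧
      Set.range f
        = {v : (Fin s → ℂ) × (Fin n → ℂ) | TangentAt s Λ X v ∧
            ∀ u : (Fin s → ℂ) × (Fin n → ℂ), TangentAt s Λ X u → dAlpha v u = 0} := by
  have hset : {v : (Fin s → ℂ) × (Fin n → ℂ) | TangentAt s Λ X v ∧
        ∀ u : (Fin s → ℂ) × (Fin n → ℂ), TangentAt s Λ X u → dAlpha v u = 0}
      = {v : (Fin s → ℂ) × (Fin n → ℂ) | ∃ (T : ℂ) (μ : ℝ),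
          v = (0, fun j => -Complex.I * (((2 * (T * Λ j).re + μ : ℝ) : ℂ) * X.2 j))} := by
    ext v
    rw [Set.mem_ofPred_eq, Set.mem_ofPred_eq, forall_dAlpha_eq_zero_iff_mem_span hw,
      neg_I_smul_mem_span_bindingNormals_iff, and_iff_right_iff_imp]
    rintro ⟨T, μ, rfl⟩
    exact tangentAt_neg_I_smul hw _
  obtain ⟨hF, hρ⟩ := hX
  simp only [hw, Pi.zero_apply, ne_eq, OfNat.ofNat_ne_zero, not_false_eq_true, zero_pow, map_zero,
    Finset.sum_const_zero, zero_add] at hF hρ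
  refine ⟨hset, bindingKernelMap s Λ X.2, bindingKernelMap_injective hΛ hF hρ, ?_⟩
  rw [hset]
  ext v
  simp only [Set.mem_range, Prod.exists, Set.mem_ofPred_eq]
  exact exists₂_congr fun T μ => eq_comm
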